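/- If s ∈ ω^{≤k} has length k−1, then the subspace T^k[s] = closed span{e_v : s ⊑ v} of T_k(d,θ) is isomorphic to ℓ_p, where dθ = d^{1/p}. -/

import Mathlib

/-- Non-decreasing list of naturals. -/
abbrev NonDec (l : List ℕ) : Prop := l.Chain' (· ≤ ·)

/-- The order `≺` on nondecreasing sequences: the empty sequence is minimal;
nonempty sequences are compared by last entry, with lexicographic tie-breaking. -/
def prec (s t : List ℕ) : Prop :=
  (s = [] ∧ t ≠ []) ∨
  (s ≠ [] ∧ t ≠ [] ∧ (s.getLast! < t.getLast! ∨
    (s.getLast! = t.getLast! ∧ List.Lex (· < ·) s t)))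

/-- The map `X̂_v`: `(m_1,…,m_l) ↦ (f_1(m_1),…,f_l(m_l))` where
`f_j(0) = n_j` and `f_j(m) = n_k + m` for `m ≥ 1`, `v = (n_1,…,n_k)`. -/
def Xhat (v s : List ℕ) : List ℕ :=
  List.zipWith (fun a b => if b = 0 then a else v.getLast! + b) (v.take s.length) s

/-- The set `X_v^max`, described by its characterization:
`w ∈ X_v^max` iff `w` is nondecreasing of the same length as `v` and either
`w_1 > n_k`, or there is `1 ≤ i ≤ k` with `(w_1,…,w_i) = (n_1,…,n_i)` and
(if `i < k`) `w_{i+1} > n_k`. -/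
def XmaxSet (v : List ℕ) : Set (List ℕ) :=
  { w | w.length = v.length ∧ NonDec w ∧
    (v.getLast! < w.headI ∨
      ∃ i, 1 ≤ i ∧ i ≤ v.length ∧ w.take i = v.take i ∧
        (i < v.length → v.getLast! < w.getD i 0)) }

/-- An `E_k`-tree: a map on `ω^{≤k}` sending nondecreasing sequences of length `≤ k`
to nondecreasing sequences of the same length, preserving `≺` and initial segments. -/
def IsEkTree (k : ℕ) (X : List ℕ → List ℕ) : Prop :=
  (∀ s, NonDec s → s.length ≤ k → NonDec (X s) ∧ (X s).length = s.length) ∧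
  (∀ s t, NonDec s → NonDec t → s.length ≤ k → t.length ≤ k →
    (prec s t → prec (X s) (X t)) ∧ (s <+: t → X s <+: X t))

/-- `E ∈ AR^k`: `E` is a finite `≺`-initial segment of the restriction to `ω^{[k]}`
of some `E_k`-tree. -/
def memAR (k : ℕ) (E : Finset (List ℕ)) : Prop :=
  ∃ X : List ℕ → List ℕ, IsEkTree k X ∧
    (∀ e ∈ E, ∃ s, NonDec s ∧ s.length = k ∧ e = X s) ∧
    (∀ s, NonDec s → s.length = k → ∀ e ∈ E, prec (X s) e → X s ∈ E)

/-- `ω^{[k]}`: nondecreasing sequences of naturals of length exactly `k`. -/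
abbrev Vec (k : ℕ) := {l : List ℕ // NonDec l ∧ l.length = k}

/-- Restriction `Ex` of a finitely supported vector to a set of coordinates. -/
noncomputable def restrict {k : ℕ} (E : Finset (Vec k)) (x : Vec k →₀ ℝ) : Vec k →₀ ℝ :=
  x.filter (fun v => v ∈ E)

/-- `A < B`: every element of `A` is `≺`-below every element of `B`. -/
def Successive {k : ℕ} (A B : Finset (Vec k)) : Prop :=
  ∀ a ∈ A, ∀ b ∈ B, prec a.1 b.1

/-- Membership in `AR^k` for finite sets of elements of `ω^{[k]}`. -/
def memARV (k : ℕ) (E : Finset (Vec k)) : Prop :=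
  memAR k (E.image Subtype.val)

/-- A `d`-admissible sequence: at most `d` many `≺`-successive members of `AR^k`. -/
def Admissible (k d : ℕ) {m : ℕ} (E : Fin m → Finset (Vec k)) : Prop :=
  m ≤ d ∧ (∀ i, memARV k (E i)) ∧ ∀ i j, i < j → Successive (E i) (E j)

/-- The nondecreasing sequence of norms `|x|_j` defining the Tsirelson-type norm:
`|x|_0 = max |x_v|`, and `|x|_{j+1}` is the max of `|x|_j` and
`θ ∑ |E_i x|_j` over admissible sequences `(E_i)_{i=1}^m`, `1 ≤ m ≤ d`. -/
noncomputable def normSeq (k d : ℕ) (θ : ℝ) : ℕ → (Vec k →₀ ℝ) → ℝ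
  | 0, x => ⨆ v, |x v|
  | j + 1, x => max (normSeq k d θ j x)
      (sSup { r | ∃ m : ℕ, 1 ≤ m ∧ ∃ E : Fin m → Finset (Vec k),
        Admissible k d E ∧ r = θ * ∑ i, normSeq k d θ j (restrict (E i) x) })

/-- The norm of `T_k(d,θ)` on finitely supported vectors. -/
noncomputable def tnorm (k d : ℕ) (θ : ℝ) (x : Vec k →₀ ℝ) : ℝ :=
  ⨆ j, normSeq k d θ j x


lemma prec_irrefl (s : List ℕ) : ¬ prec s s := by
  rintro (⟨h, h'⟩ | ⟨-, -, h | ⟨-, h⟩⟩)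
  · exact h' h
  · exact lt_irrefl _ h
  · exact lt_irrefl s h

lemma prec_trans {s t u : List ℕ} (h₁ : prec s t) (h₂ : prec t u) : prec s u := by
  rcases h₁ with ⟨a, b⟩ | ⟨a, b, c⟩ <;> rcases h₂ with ⟨a', b'⟩ | ⟨a', b', c'⟩
  · exact absurd a' b
  · exact Or.inl ⟨a, b'⟩
  · exact absurd a' b
  · refine Or.inr ⟨a, b', ?_⟩
    rcases c with c | ⟨c, l⟩ <;> rcases c' with c' | ⟨c', l'⟩
    · exact Or.inl (c.trans c')
    · exact Or.inl (c'.symm ▸ c)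
    · exact Or.inl (c.symm ▸ c')
    · exact Or.inr ⟨c.trans c', lt_trans (a := s) (b := t) (c := u) l l'⟩

lemma NonDec.getElem_le {l : List ℕ} (hl : NonDec l) {i j : ℕ} (hij : i ≤ j)
    (hj : j < l.length) : l[i] ≤ l[j] := by
  rcases hij.lt_or_eq with h | rfl
  · exact List.pairwise_iff_getElem.1 (List.isChain_iff_pairwise.1 hl) i j _ hj h
  · exact le_rfl

lemma nonDec_of_getElem_le {l : List ℕ}
    (h : ∀ i j (hij : i < j) (hj : j < l.length), l[i] ≤ l[j]) : NonDec l :=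
  List.isChain_iff_pairwise.2 (List.pairwise_iff_getElem.2 fun i j _ hj hij => h i j hij hj)

lemma getLast!_eq_getElem {l : List ℕ} (hl : l ≠ []) :
    l.getLast! = l[l.length - 1]'(by have := List.length_pos_iff.2 hl; omega) := by
  rw [List.getLast!_of_getLast? (List.getLast?_eq_some_getLast hl), List.getLast_eq_getElem]

lemma NonDec.le_getLast! {l : List ℕ} (hl : NonDec l) {n : ℕ} (hn : n ∈ l) :
    n ≤ l.getLast! := by
  obtain ⟨i, hi, rfl⟩ := List.getElem_of_mem hn
  rw [getLast!_eq_getElem (List.ne_nil_of_mem hn)]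
  exact hl.getElem_le (by omega) _

/-- The coordinate map of the tree with first branch `v` and last entry `L`. -/
def shiftEntry (L a b : ℕ) : ℕ := if b = 0 then a else L + b

lemma shiftEntry_lt {L a b c : ℕ} (ha : a ≤ L) (h : b < c) :
    shiftEntry L a b < shiftEntry L a c := by
  unfold shiftEntry; split_ifs <;> omega

lemma shiftEntry_le {L a a' b c : ℕ} (ha : a ≤ L) (haa : a ≤ a') (h : b ≤ c) :
    shiftEntry L a b ≤ shiftEntry L a' c := by
  unfold shiftEntry; split_ifs <;> omega

/-- The tree whose `≺`-least element of maximal length is `v`. -/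
def shiftTree (v t : List ℕ) : List ℕ := List.zipWith (shiftEntry v.getLast!) v t

lemma length_shiftTree {v t : List ℕ} (h : t.length ≤ v.length) :
    (shiftTree v t).length = t.length := by
  simp [shiftTree, h]

lemma shiftTree_nonDec {v t : List ℕ} (hv : NonDec v) (ht : NonDec t)
    (h : t.length ≤ v.length) : NonDec (shiftTree v t) := by
  refine nonDec_of_getElem_le fun i j hij hj => ?_
  have hj' : j < t.length := by rwa [length_shiftTree h] at hj
  simp only [shiftTree, List.getElem_zipWith]
  exact shiftEntry_le (hv.le_getLast! (List.getElem_mem _)) (hv.getElem_le hij.le _)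
    (ht.getElem_le hij.le _)

lemma getLast!_shiftTree {v t : List ℕ} (h : t.length ≤ v.length) (ht : t ≠ []) :
    (shiftTree v t).getLast! = shiftEntry v.getLast!
      (v[t.length - 1]'(by have := List.length_pos_iff.2 ht; omega)) t.getLast! := by
  have hl := length_shiftTree h
  have hn : shiftTree v t ≠ [] := by
    rw [← List.length_pos_iff, hl]; exact List.length_pos_iff.2 ht
  rw [getLast!_eq_getElem hn, getLast!_eq_getElem ht]
  simp [shiftTree, h]

lemma lex_zipWith_shiftEntry {L : ℕ} {s t : List ℕ} (h : List.Lex (· < ·) s t) :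
    ∀ v : List ℕ, (∀ n ∈ v, n ≤ L) → s.length ≤ v.length → t.length ≤ v.length →
      List.Lex (· < ·) (List.zipWith (shiftEntry L) v s) (List.zipWith (shiftEntry L) v t) := by
  induction h with
  | nil =>
    intro v _ _ h
    cases v with
    | nil => simp at h
    | cons a v => simp
  | cons _ ih =>
    intro v hv h₁ h₂
    cases v with
    | nil => simp at h₁
    | cons a v =>
      exact List.Lex.cons (ih v (fun n hn => hv n (by simp [hn])) (by simpa using h₁)
        (by simpa using h₂))
  | rel hab =>
    intro v hv h₁ h₂
    cases v with
    | nil => simp at h₁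
    | cons a v => exact List.Lex.rel (shiftEntry_lt (hv a (by simp)) hab)

lemma length_lt_of_lex_of_eq_zero {s t : List ℕ} (h : List.Lex (· < ·) s t) :
    (∀ n ∈ t, n = 0) → s.length < t.length := by
  induction h with
  | nil => simp
  | cons _ ih => intro h; simpa using ih fun n hn => h n (by simp [hn])
  | rel hab => intro h; exact absurd (h _ List.mem_cons_self) (by omega)

lemma shiftTree_prec {v s t : List ℕ} (hv : NonDec v) (ht : NonDec t)
    (hs : s.length ≤ v.length) (htl : t.length ≤ v.length) (h : prec s t) :
    prec (shiftTree v s) (shiftTree v t) := by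
  have ne_nil : ∀ {r : List ℕ}, r.length ≤ v.length → r ≠ [] → shiftTree v r ≠ [] := by
    intro r hr hr0
    rw [← List.length_pos_iff, length_shiftTree hr]; exact List.length_pos_iff.2 hr0
  rcases h with ⟨rfl, h⟩ | ⟨hs0, ht0, h⟩
  · exact Or.inl ⟨by simp [shiftTree], ne_nil htl h⟩
  refine Or.inr ⟨ne_nil hs hs0, ne_nil htl ht0, ?_⟩
  have h1 := List.length_pos_iff.2 hs0
  have h2 := List.length_pos_iff.2 ht0
  rw [getLast!_shiftTree hs hs0, getLast!_shiftTree htl ht0]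
  have hle := hv.le_getLast! (List.getElem_mem (l := v) (n := s.length - 1) (by omega))
  rcases h with h | ⟨h, hlex⟩
  · left
    unfold shiftEntry
    split_ifs <;> omega
  · have hlex' : List.Lex (· < ·) (shiftTree v s) (shiftTree v t) :=
      lex_zipWith_shiftEntry hlex v (fun n hn => hv.le_getLast! hn) hs htl
    have key : shiftEntry v.getLast! (v[s.length - 1]'(by omega)) s.getLast! ≤
        shiftEntry v.getLast! (v[t.length - 1]'(by omega)) t.getLast! := by
      rw [h]
      by_cases h0 : t.getLast! = 0
      · have := length_lt_of_lex_of_eq_zero hlex fun n hn => by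
          have := ht.le_getLast! hn; omega
        exact shiftEntry_le hle (hv.getElem_le (by omega) _) le_rfl
      · simp only [shiftEntry, h0, if_false, le_refl]
    rcases key.lt_or_eq with h' | h'
    · exact Or.inl h'
    · exact Or.inr ⟨h', hlex'⟩

lemma shiftTree_prefix {v s t : List ℕ} (h : s <+: t) : shiftTree v s <+: shiftTree v t := by
  obtain ⟨r, rfl⟩ := h
  have : shiftTree v s = (shiftTree v (s ++ r)).take s.length := by
    refine List.ext_getElem (by simp [shiftTree]; omega) fun i hi _ => ?_
    have hi' : i < s.length := by simp [shiftTree] at hi; omega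
    simp [shiftTree, List.getElem_append_left hi']
  rw [this]
  exact List.take_prefix _ _

lemma shiftTree_isEkTree {k : ℕ} {v : List ℕ} (hv : NonDec v) (hk : v.length = k) :
    IsEkTree k (shiftTree v) := by
  subst hk
  exact ⟨fun s hs h => ⟨shiftTree_nonDec hv hs h, length_shiftTree h⟩,
    fun s t _ ht h h' => ⟨shiftTree_prec hv ht h h', shiftTree_prefix⟩⟩

lemma memARV_empty (k : ℕ) : memARV k ∅ := by
  refine ⟨id, ⟨fun s hs _ => ⟨hs, rfl⟩, fun s t _ _ _ _ => ⟨id, id⟩⟩, ?_, ?_⟩ <;> simp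

lemma shiftTree_zero (v : List ℕ) : shiftTree v (List.replicate v.length 0) = v := by
  refine List.ext_getElem (by simp [shiftTree]) fun i _ _ => ?_
  simp [shiftTree, shiftEntry]

lemma eq_or_getLast!_lt_of_shiftTree {v t : List ℕ} (ht : NonDec t)
    (h : t.length = v.length) : shiftTree v t = v ∨ v.getLast! < (shiftTree v t).getLast! := by
  by_cases h0 : t = []
  · subst h0; left
    have : v = [] := by simpa [eq_comm] using h
    simp [this, shiftTree]
  by_cases hz : t.getLast! = 0
  · left
    have : t = List.replicate v.length 0 :=
      List.eq_replicate_iff.2 ⟨h, fun n hn => by have := ht.le_getLast! hn; omega⟩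
    rw [this, shiftTree_zero]
  · right
    rw [getLast!_shiftTree h.le h0]
    simp only [shiftEntry, hz, if_false]
    omega

lemma Vec.ne_nil {k : ℕ} (hk : 1 ≤ k) (w : Vec k) : w.1 ≠ [] := by
  rw [← List.length_pos_iff, w.2.2]; exact hk

lemma Vec.eq_append_getLast! {k : ℕ} (hk : 1 ≤ k) {s : List ℕ} (hsl : s.length = k - 1)
    {w : Vec k} (h : s <+: w.1) : w.1 = s ++ [w.1.getLast!] := by
  obtain ⟨r, hr⟩ := h
  have hl : s.length + r.length = k := by rw [← List.length_append, hr, w.2.2]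
  obtain ⟨n, rfl⟩ := List.length_eq_one_iff.1 (show r.length = 1 by omega)
  rw [← hr]; simp

lemma exists_shiftTree_eq {k : ℕ} (hk : 1 ≤ k) {s : List ℕ} (hsl : s.length = k - 1)
    {a w : Vec k} (ha : s <+: a.1) (hw : s <+: w.1) (h : a.1.getLast! ≤ w.1.getLast!) :
    ∃ t, NonDec t ∧ t.length = k ∧ w.1 = shiftTree a.1 t := by
  refine ⟨List.replicate (k - 1) 0 ++ [w.1.getLast! - a.1.getLast!], ?_, by simp; omega, ?_⟩
  · refine nonDec_of_getElem_le fun i j hij hj => ?_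
    have : i < k - 1 := by simp at hj; omega
    rw [List.getElem_append_left (by simpa using this)]
    simp
  · have ha' := Vec.eq_append_getLast! hk hsl ha
    have hw' := Vec.eq_append_getLast! hk hsl hw
    set L := a.1.getLast! with hL
    set M := w.1.getLast! with hM
    have hs0 : List.zipWith (shiftEntry L) s (List.replicate (k - 1) 0) = s := by
      refine List.ext_getElem (by simp [hsl]) fun i _ _ => ?_
      simp [shiftEntry]
    rw [shiftTree, ← hL, hw', ha', List.zipWith_append (by simp [hsl]), hs0]
    simp only [List.zipWith_cons_cons, List.zipWith_nil_right, shiftEntry]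
    congr 2
    split_ifs <;> omega

/-- Every set of nodes above `s` has an element of `AR^k` that meets `τ^k[s]` in the interval it
spans and lies between its least and greatest nodes. -/
lemma exists_memARV {k : ℕ} (hk : 1 ≤ k) {s : List ℕ} (hsl : s.length = k - 1)
    (S : Finset (Vec k)) (hS : ∀ w ∈ S, s <+: w.1) :
    ∃ E : Finset (Vec k), memARV k E ∧
      (∀ w : Vec k, s <+: w.1 → (w ∈ E ↔
        ∃ a ∈ S, ∃ b ∈ S, a.1.getLast! ≤ w.1.getLast! ∧ w.1.getLast! ≤ b.1.getLast!)) ∧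
      ∀ e ∈ E, ∃ a ∈ S, ∃ b ∈ S, (e = a ∨ prec a.1 e.1) ∧ (e = b ∨ prec e.1 b.1) := by
  rcases S.eq_empty_or_nonempty with rfl | hne
  · exact ⟨∅, memARV_empty k, by simp, by simp⟩
  obtain ⟨a, haS, ha⟩ := S.exists_min_image (fun w => w.1.getLast!) hne
  obtain ⟨b, hbS, hb⟩ := S.exists_max_image (fun w => w.1.getLast!) hne
  have hfin : {w : Vec k | (∃ t, NonDec t ∧ t.length = k ∧ w.1 = shiftTree a.1 t) ∧
      (w = b ∨ prec w.1 b.1)}.Finite := by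
    refine Set.Finite.of_finite_image (f := Subtype.val) ?_ Subtype.val_injective.injOn
    refine (List.finite_length_eq (Fin (b.1.getLast! + 1)) k).image (List.map Fin.val)
      |>.subset ?_
    rintro _ ⟨w, ⟨-, hw⟩, rfl⟩
    have hle : w.1.getLast! ≤ b.1.getLast! := by
      rcases hw with rfl | ⟨h, -⟩ | ⟨-, -, h | ⟨h, -⟩⟩
      · exact le_rfl
      · exact absurd h (w.ne_nil hk)
      · exact h.le
      · exact h.le
    refine ⟨w.1.map fun n => Fin.ofNat (b.1.getLast! + 1) n, by simp [w.2.2], ?_⟩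
    rw [List.map_map]
    conv_rhs => rw [← List.map_id w.1]
    refine List.map_congr_left fun n hn => ?_
    have := w.2.1.le_getLast! hn
    simp only [Function.comp, Fin.val_ofNat, id]
    exact Nat.mod_eq_of_lt (by omega)
  refine ⟨hfin.toFinset, ⟨shiftTree a.1, shiftTree_isEkTree a.2.1 a.2.2, ?_, ?_⟩, ?_, ?_⟩
  · intro e he
    simp only [Finset.mem_image, Set.Finite.mem_toFinset] at he
    obtain ⟨w, ⟨⟨t, h₁, h₂, h₃⟩, -⟩, rfl⟩ := he
    exact ⟨t, h₁, h₂, h₃⟩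
  · intro t ht htl e he hte
    simp only [Finset.mem_image, Set.Finite.mem_toFinset] at he ⊢
    obtain ⟨w, ⟨-, hw⟩, rfl⟩ := he
    have hl : t.length ≤ a.1.length := by rw [a.2.2, htl]
    refine ⟨⟨shiftTree a.1 t, shiftTree_nonDec a.2.1 ht hl, by rw [length_shiftTree hl, htl]⟩,
      ⟨⟨t, ht, htl, rfl⟩, Or.inr ?_⟩, rfl⟩
    rcases hw with rfl | hw
    · exact hte
    · exact prec_trans hte hw
  · intro w hw
    simp only [Set.Finite.mem_toFinset, Set.mem_ofPred_eq]
    constructor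
    · rintro ⟨⟨t, ht, htl, hwt⟩, hwb⟩
      refine ⟨a, haS, b, hbS, ?_, ?_⟩
      · rw [hwt]
        rcases eq_or_getLast!_lt_of_shiftTree ht (htl.trans a.2.2.symm) with h | h
        · rw [h]
        · exact h.le
      · rcases hwb with rfl | ⟨h, -⟩ | ⟨-, -, h | ⟨h, -⟩⟩
        · exact le_rfl
        · exact absurd h (w.ne_nil hk)
        · exact h.le
        · exact h.le
    · rintro ⟨a', ha', b', hb', h₁, h₂⟩
      refine ⟨exists_shiftTree_eq hk hsl (hS a haS) hw ((ha a' ha').trans h₁), ?_⟩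
      rcases (h₂.trans (hb b' hb')).lt_or_eq with h | h
      · exact Or.inr (Or.inr ⟨w.ne_nil hk, b.ne_nil hk, Or.inl h⟩)
      · refine Or.inl (Subtype.ext ?_)
        rw [Vec.eq_append_getLast! hk hsl hw, Vec.eq_append_getLast! hk hsl (hS b hbS), h]
  · intro e he
    simp only [Set.Finite.mem_toFinset, Set.mem_ofPred_eq] at he
    obtain ⟨⟨t, ht, htl, hwt⟩, heb⟩ := he
    refine ⟨a, haS, b, hbS, ?_, heb⟩
    rcases eq_or_getLast!_lt_of_shiftTree ht (htl.trans a.2.2.symm) with h | h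
    · exact Or.inl (Subtype.ext (hwt.trans h))
    · exact Or.inr (Or.inr ⟨a.ne_nil hk, e.ne_nil hk, Or.inl (by rw [hwt]; exact h)⟩)

/-- The `p`-th power of the `ℓ_p`-norm. -/
noncomputable def powSum {k : ℕ} (p : ℝ) (x : Vec k →₀ ℝ) : ℝ := ∑ w ∈ x.support, |x w| ^ p

lemma powSum_nonneg {k : ℕ} (p : ℝ) (x : Vec k →₀ ℝ) : 0 ≤ powSum p x :=
  Finset.sum_nonneg fun _ _ => by positivity

lemma powSum_restrict {k : ℕ} (p : ℝ) (E : Finset (Vec k)) (x : Vec k →₀ ℝ) :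
    powSum p (restrict E x) = ∑ w ∈ x.support, if w ∈ E then |x w| ^ p else 0 := by
  rw [powSum, restrict, Finsupp.support_filter, Finset.sum_filter]
  refine Finset.sum_congr rfl fun w _ => ?_
  split_ifs with h
  · rw [Finsupp.filter_apply_pos _ _ h]
  · rfl

lemma sum_powSum_restrict_le {k d m : ℕ} (p : ℝ) {E : Fin m → Finset (Vec k)}
    (hE : Admissible k d E) (x : Vec k →₀ ℝ) :
    ∑ i, powSum p (restrict (E i) x) ≤ powSum p x := by
  simp only [powSum_restrict]
  rw [Finset.sum_comm]
  refine Finset.sum_le_sum fun w _ => ?_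
  by_cases h : ∃ i, w ∈ E i
  · obtain ⟨i, hi⟩ := h
    rw [Finset.sum_eq_single i, if_pos hi]
    · intro j _ hji
      rw [if_neg]
      intro hj
      rcases lt_or_gt_of_ne hji with h | h
      · exact prec_irrefl _ (hE.2.2 _ _ h w hj w hi)
      · exact prec_irrefl _ (hE.2.2 _ _ h w hi w hj)
    · simp
  · push Not at h
    rw [Finset.sum_eq_zero fun i _ => if_neg (h i)]
    positivity

lemma bddAbove_abs {k : ℕ} (x : Vec k →₀ ℝ) : BddAbove (Set.range fun v => |x v|) := by
  refine ⟨∑ w ∈ x.support, |x w|, ?_⟩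
  rintro _ ⟨v, rfl⟩
  by_cases hv : v ∈ x.support
  · exact Finset.single_le_sum (f := fun w => |x w|) (fun _ _ => abs_nonneg _) hv
  · simp only [Finsupp.notMem_support_iff.1 hv, abs_zero]
    exact Finset.sum_nonneg fun _ _ => abs_nonneg _

lemma abs_le_powSum {k : ℕ} {p : ℝ} (hp : 1 < p) (x : Vec k →₀ ℝ) (v : Vec k) :
    |x v| ≤ powSum p x ^ (1 / p) := by
  have hp0 : p ≠ 0 := by positivity
  by_cases hv : v ∈ x.support
  · calc |x v| = (|x v| ^ p) ^ (1 / p) := by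
          rw [one_div, Real.rpow_rpow_inv (abs_nonneg _) hp0]
      _ ≤ _ := by
          refine Real.rpow_le_rpow (by positivity) ?_ (by positivity)
          exact Finset.single_le_sum (f := fun w => |x w| ^ p) (fun _ _ => by positivity) hv
  · rw [Finsupp.notMem_support_iff.1 hv, abs_zero]
    exact Real.rpow_nonneg (powSum_nonneg _ _) _

lemma sum_restrict_le {k d m : ℕ} {θ p : ℝ} (hθ0 : 0 < θ) (hd : 1 ≤ d) (hp : 1 < p)
    (hdp : (d : ℝ) * θ = (d : ℝ) ^ (1 / p)) {E : Fin m → Finset (Vec k)}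
    (hE : Admissible k d E) (x : Vec k →₀ ℝ) :
    θ * ∑ i, powSum p (restrict (E i) x) ^ (1 / p) ≤ powSum p x ^ (1 / p) := by
  have hp0 : 0 < p := by positivity
  have hd0 : (0 : ℝ) < d := by exact_mod_cast hd
  have hnn : ∀ i, 0 ≤ powSum p (restrict (E i) x) ^ (1 / p) := fun i =>
    Real.rpow_nonneg (powSum_nonneg _ _) _
  have hsum : 0 ≤ ∑ i, powSum p (restrict (E i) x) ^ (1 / p) :=
    Finset.sum_nonneg fun i _ => hnn i
  have hθp : θ ^ p * (d : ℝ) ^ (p - 1) = 1 := by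
    have h : ((d : ℝ) * θ) ^ p = d := by
      rw [hdp, one_div, Real.rpow_inv_rpow hd0.le hp0.ne']
    rw [Real.mul_rpow hd0.le hθ0.le] at h
    rw [Real.rpow_sub_one hd0.ne', mul_div_assoc', mul_comm, h, div_self hd0.ne']
  rw [one_div p, Real.le_rpow_inv_iff_of_pos (by rw [← one_div]; positivity) (powSum_nonneg _ _) hp0,
    ← one_div, Real.mul_rpow hθ0.le hsum]
  have hH := Real.rpow_sum_le_const_mul_sum_rpow (s := Finset.univ)
    (f := fun i => powSum p (restrict (E i) x) ^ (1 / p)) hp.le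
  simp only [abs_of_nonneg (hnn _), Finset.card_univ, Fintype.card_fin] at hH
  have hpow : ∀ i, (powSum p (restrict (E i) x) ^ (1 / p)) ^ p = powSum p (restrict (E i) x) :=
    fun i => by rw [one_div, Real.rpow_inv_rpow (powSum_nonneg _ _) hp0.ne']
  simp only [hpow] at hH
  calc _ ≤ θ ^ p * ((m : ℝ) ^ (p - 1) * ∑ i, powSum p (restrict (E i) x)) := by gcongr
    _ ≤ θ ^ p * ((d : ℝ) ^ (p - 1) * powSum p x) := by
        gcongr
        · exact Finset.sum_nonneg fun i _ => powSum_nonneg _ _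
        · exact hE.1
        · exact sum_powSum_restrict_le p hE x
    _ = powSum p x := by rw [← mul_assoc, hθp, one_mul]

lemma normSeq_le_powSum {k d : ℕ} {θ p : ℝ} (hθ0 : 0 < θ) (hd : 1 ≤ d) (hp : 1 < p)
    (hdp : (d : ℝ) * θ = (d : ℝ) ^ (1 / p)) (j : ℕ) :
    ∀ x : Vec k →₀ ℝ, normSeq k d θ j x ≤ powSum p x ^ (1 / p) := by
  induction j with
  | zero =>
    exact fun x => Real.iSup_le (abs_le_powSum hp x) (Real.rpow_nonneg (powSum_nonneg _ _) _)
  | succ j ih =>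
    refine fun x => max_le (ih x) (Real.sSup_le ?_ (Real.rpow_nonneg (powSum_nonneg _ _) _))
    rintro r ⟨m, -, E, hE, rfl⟩
    refine le_trans ?_ (sum_restrict_le hθ0 hd hp hdp hE x)
    gcongr with i
    exact ih _

lemma le_normSeq_succ {k d m : ℕ} {θ p : ℝ} (hθ0 : 0 < θ) (hd : 1 ≤ d) (hp : 1 < p)
    (hdp : (d : ℝ) * θ = (d : ℝ) ^ (1 / p)) (j : ℕ) (x : Vec k →₀ ℝ) (hm : 1 ≤ m)
    {E : Fin m → Finset (Vec k)} (hE : Admissible k d E) :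
    θ * ∑ i, normSeq k d θ j (restrict (E i) x) ≤ normSeq k d θ (j + 1) x := by
  have hmem : θ * ∑ i, normSeq k d θ j (restrict (E i) x) ∈ { r | ∃ m : ℕ, 1 ≤ m ∧
      ∃ E : Fin m → Finset (Vec k), Admissible k d E ∧
        r = θ * ∑ i, normSeq k d θ j (restrict (E i) x) } := ⟨m, hm, E, hE, rfl⟩
  refine le_trans (le_csSup ?_ hmem) (le_max_right _ _)
  refine ⟨powSum p x ^ (1 / p), ?_⟩
  rintro r ⟨m, -, E, hE, rfl⟩
  refine le_trans ?_ (sum_restrict_le hθ0 hd hp hdp hE x)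
  gcongr with i
  exact normSeq_le_powSum hθ0 hd hp hdp j _

lemma abs_le_normSeq {k d : ℕ} {θ : ℝ} (j : ℕ) (x : Vec k →₀ ℝ) (v : Vec k) :
    |x v| ≤ normSeq k d θ j x := by
  induction j with
  | zero => exact le_ciSup (bddAbove_abs x) v
  | succ j ih => exact ih.trans (le_max_left _ _)

lemma sum_le_of_card_le_one {k d N : ℕ} {θ : ℝ} (hθ0 : 0 < θ) (hθ1 : θ < 1)
    {x : Vec k →₀ ℝ} {ℓ : Vec k → ℕ} (h : x.support.card ≤ 1) :
    ∑ w ∈ x.support, θ ^ ℓ w * |x w| ≤ normSeq k d θ N x := by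
  rcases x.support.eq_empty_or_nonempty with h0 | ⟨v, hv⟩
  · obtain rfl := Finsupp.support_eq_empty.1 h0
    simpa using abs_le_normSeq N (0 : Vec k →₀ ℝ) (d := d) (θ := θ)
      ⟨List.replicate k 0, nonDec_of_getElem_le (by simp), by simp⟩
  · rw [Finset.sum_eq_single_of_mem v hv fun w hw hne =>
      absurd (Finset.card_le_one.1 h w hw v hv) hne]
    calc θ ^ ℓ v * |x v| ≤ 1 * |x v| := by gcongr; exact pow_le_one₀ hθ0.le hθ1.le
      _ ≤ _ := by rw [one_mul]; exact abs_le_normSeq N x v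

/-- Lower estimate by a `d`-adic splitting: nodes are assigned positions `y` in an interval of
length `h`, separated by at least the gaps `r`; a node whose gap exceeds `h / d ^ ℓ` is isolated
after at most `ℓ` splittings. -/
lemma sum_pow_mul_abs_le_normSeq {k d : ℕ} (hk : 1 ≤ k) {θ p : ℝ} (hθ0 : 0 < θ) (hθ1 : θ < 1)
    (hd : 1 ≤ d) (hp : 1 < p) (hdp : (d : ℝ) * θ = (d : ℝ) ^ (1 / p))
    {s : List ℕ} (hsl : s.length = k - 1) (y r : Vec k → ℝ) (N : ℕ) :
    ∀ (x : Vec k →₀ ℝ) (ℓ : Vec k → ℕ) (u h : ℝ), (∀ w ∈ x.support, s <+: w.1) →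
      (∀ w ∈ x.support, u ≤ y w ∧ y w < u + h) →
      (∀ w ∈ x.support, ∀ w' ∈ x.support, w.1.getLast! < w'.1.getLast! →
        r w ≤ y w' - y w ∧ r w' ≤ y w' - y w) →
      (∀ w ∈ x.support, 0 < r w ∧ h ≤ r w * d ^ ℓ w ∧ ℓ w ≤ N) →
      ∑ w ∈ x.support, θ ^ ℓ w * |x w| ≤ normSeq k d θ N x := by
  have hd0 : (0 : ℝ) < d := by exact_mod_cast hd
  have last_inj : ∀ {w w' : Vec k}, s <+: w.1 → s <+: w'.1 → w.1.getLast! = w'.1.getLast! →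
      w = w' := fun {w w'} h h' he => Subtype.ext (by
    rw [Vec.eq_append_getLast! hk hsl h, Vec.eq_append_getLast! hk hsl h', he])
  induction N with
  | zero =>
    intro x ℓ u h hs hy hsep hr
    have hle : x.support.card ≤ 1 := by
      refine Finset.card_le_one.2 fun w hw w' hw' => ?_
      by_contra hne
      have h1 := hr w hw
      have h2 := hr w' hw'
      have h3 := hy w hw
      have h4 := hy w' hw'
      simp only [Nat.le_zero.1 h1.2.2, Nat.le_zero.1 h2.2.2, pow_zero, mul_one] at h1 h2
      rcases lt_trichotomy w.1.getLast! w'.1.getLast! with hl | hl | hl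
      · have := hsep w hw w' hw' hl; linarith
      · exact hne (last_inj (hs w hw) (hs w' hw') hl)
      · have := hsep w' hw' w hw hl; linarith
    exact sum_le_of_card_le_one hθ0 hθ1 hle
  | succ N ih =>
    intro x ℓ u h hs hy hsep hr
    by_cases hle : x.support.card ≤ 1
    · exact sum_le_of_card_le_one hθ0 hθ1 hle
    have hmono : ∀ w ∈ x.support, ∀ w' ∈ x.support, w.1.getLast! ≤ w'.1.getLast! →
        y w ≤ y w' := by
      intro w hw w' hw' hl
      rcases hl.lt_or_eq with hl | hl
      · have := (hsep w hw w' hw' hl).1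
        have := (hr w hw).1
        linarith
      · rw [last_inj (hs w hw) (hs w' hw') hl]
    have hℓ : ∀ w ∈ x.support, 1 ≤ ℓ w := by
      intro w hw
      obtain ⟨w', hw', hne⟩ := Finset.exists_mem_ne (not_le.1 hle) w
      by_contra h0
      have h1 := hr w hw
      have h3 := hy w hw
      have h4 := hy w' hw'
      simp only [show ℓ w = 0 by omega, pow_zero, mul_one] at h1
      rcases lt_trichotomy w.1.getLast! w'.1.getLast! with hl | hl | hl
      · have := hsep w hw w' hw' hl; linarith
      · exact hne (last_inj (hs w hw) (hs w' hw') hl).symm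
      · have := hsep w' hw' w hw hl; linarith
    have hh : 0 < h := by
      obtain ⟨w, hw⟩ := Finset.card_pos.1 (by omega : 0 < x.support.card)
      have := hy w hw; linarith
    set idx : Vec k → ℕ := fun w => ⌊(y w - u) / (h / d)⌋₊ with hidx
    have hhd : 0 < h / d := by positivity
    have idx_lt : ∀ w ∈ x.support, idx w < d := by
      intro w hw
      have h3 := hy w hw
      rw [hidx, Nat.floor_lt (div_nonneg (by linarith) hhd.le), div_lt_iff₀ hhd]
      rw [mul_div_cancel₀ _ hd0.ne']
      linarith
    have idx_mono : ∀ w ∈ x.support, ∀ w' ∈ x.support, w.1.getLast! ≤ w'.1.getLast! →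
        idx w ≤ idx w' := by
      intro w hw w' hw' hl
      have := hmono w hw w' hw' hl
      exact Nat.floor_mono (by gcongr)
    choose E hE₁ hE₂ hE₃ using fun i : Fin d =>
      exists_memARV hk hsl (x.support.filter fun w => idx w = i)
        fun w hw => hs w (Finset.mem_filter.1 hw).1
    have hmem : ∀ i, ∀ w ∈ x.support, (w ∈ E i ↔ idx w = i) := by
      intro i w hw
      rw [hE₂ i w (hs w hw)]
      simp only [Finset.mem_filter]
      constructor
      · rintro ⟨a, ⟨ha, hai⟩, b, ⟨hb, hbi⟩, h₁, h₂⟩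
        have := idx_mono a ha w hw h₁
        have := idx_mono w hw b hb h₂
        omega
      · intro h
        exact ⟨w, ⟨hw, h⟩, w, ⟨hw, h⟩, le_rfl, le_rfl⟩
    have hadm : Admissible k d E := by
      refine ⟨le_rfl, hE₁, fun i j hij e he e' he' => ?_⟩
      obtain ⟨-, -, b, hb, -, hb'⟩ := hE₃ i e he
      obtain ⟨a, ha, -, -, ha', -⟩ := hE₃ j e' he'
      simp only [Finset.mem_filter] at ha hb
      have hba : prec b.1 a.1 := by
        refine Or.inr ⟨b.ne_nil hk, a.ne_nil hk, Or.inl ?_⟩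
        by_contra hlt
        have := idx_mono a ha.1 b hb.1 (not_lt.1 hlt)
        have : i.1 < j.1 := hij
        omega
      have hea : prec e.1 a.1 := by
        rcases hb' with rfl | h
        · exact hba
        · exact prec_trans h hba
      rcases ha' with rfl | h
      · exact hea
      · exact prec_trans hea h
    have hsupp : ∀ i : Fin d, (restrict (E i) x).support = x.support.filter fun w => idx w = i := by
      intro i
      rw [restrict, Finsupp.support_filter]
      exact Finset.filter_congr (hmem i)
    have hval : ∀ i : Fin d, ∀ w ∈ x.support.filter (fun w => idx w = i), restrict (E i) x w = x w := by
      intro i w hw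
      rw [Finset.mem_filter] at hw
      exact Finsupp.filter_apply_pos _ _ ((hmem i w hw.1).2 hw.2)
    refine le_trans ?_ (le_normSeq_succ hθ0 hd hp hdp N x hd hadm)
    have hpiece : ∀ i : Fin d, ∑ w ∈ x.support.filter (fun w => idx w = i), θ ^ (ℓ w - 1) * |x w| ≤
        normSeq k d θ N (restrict (E i) x) := by
      intro i
      have := ih (restrict (E i) x) (fun w => ℓ w - 1) (u + i * (h / d)) (h / d)
      rw [hsupp] at this
      simp only [Finset.mem_filter] at this
      refine le_trans (Finset.sum_congr rfl fun w hw => by rw [hval i w hw]).ge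
        (this (fun w hw => hs w hw.1) ?_ ?_ ?_)
      · rintro w ⟨hw, hwi⟩
        have h3 := hy w hw
        rw [hidx, Nat.floor_eq_iff (div_nonneg (by linarith) hhd.le), le_div_iff₀ hhd,
          div_lt_iff₀ hhd] at hwi
        constructor <;> linarith
      · exact fun w hw w' hw' => hsep w hw.1 w' hw'.1
      · rintro w ⟨hw, -⟩
        obtain ⟨h1, h2, h3⟩ := hr w hw
        have h4 := hℓ w hw
        refine ⟨h1, ?_, by omega⟩
        rw [div_le_iff₀ hd0, mul_assoc, ← pow_succ, Nat.sub_add_cancel h4]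
        exact h2
    calc ∑ w ∈ x.support, θ ^ ℓ w * |x w|
        = θ * ∑ w ∈ x.support, θ ^ (ℓ w - 1) * |x w| := by
          rw [Finset.mul_sum]
          refine Finset.sum_congr rfl fun w hw => ?_
          rw [← mul_assoc, ← pow_succ', Nat.sub_add_cancel (hℓ w hw)]
      _ = θ * ∑ i : Fin d, ∑ w ∈ x.support.filter (fun w => idx w = i),
            θ ^ (ℓ w - 1) * |x w| := by
          rw [Fin.sum_univ_eq_sum_range (fun i => ∑ w ∈ x.support.filter (fun w => idx w = i),
            θ ^ (ℓ w - 1) * |x w|), Finset.sum_fiberwise_of_maps_to]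
          exact fun w hw => Finset.mem_range.2 (idx_lt w hw)
      _ ≤ _ := by
          gcongr with i
          exact hpiece i

lemma exists_depth {d : ℕ} {θ p a A : ℝ} (hd : 2 ≤ d) (hp : 1 < p)
    (hdp : (d : ℝ) * θ = (d : ℝ) ^ (1 / p)) (ha : 0 < a) (haA : a ≤ A) :
    ∃ ℓ : ℕ, A ≤ a / 2 * d ^ ℓ ∧
      1 / (2 * d) * A ^ (1 / p) * (a / A) ≤ θ ^ ℓ * a ^ (1 / p) := by
  have hd2 : (2 : ℝ) ≤ d := by exact_mod_cast hd
  have hd0 : (0 : ℝ) < d := by linarith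
  have hA : 0 < A := ha.trans_le haA
  have hp1 : 1 / p < 1 := by rw [div_lt_one (by linarith)]; exact hp
  have hp0 : 0 < 1 / p := by positivity
  obtain ⟨n, hn₁, hn₂⟩ := exists_nat_pow_near_of_lt_one (x := a / (2 * A)) (y := 1 / (d : ℝ))
    (by positivity) (by rw [div_le_one (by positivity)]; linarith) (by positivity)
    (by rw [div_lt_one hd0]; linarith)
  refine ⟨n + 1, ?_, ?_⟩
  · rw [one_div, inv_pow, inv_lt_iff_one_lt_mul₀ (by positivity), div_mul_eq_mul_div,
      one_lt_div (by positivity)] at hn₁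
    linarith
  · have hθ : θ = (1 / (d : ℝ)) ^ (1 - 1 / p) := by
      rw [one_div, Real.inv_rpow hd0.le, ← Real.rpow_neg hd0.le, neg_sub,
        Real.rpow_sub_one hd0.ne', ← hdp, mul_div_cancel_left₀ _ hd0.ne']
    have hpow : θ ^ (n + 1) = ((1 / (d : ℝ)) ^ (n + 1)) ^ (1 - 1 / p) := by
      rw [hθ, ← Real.rpow_mul_natCast (by positivity), ← Real.rpow_natCast_mul (by positivity),
        mul_comm]
    have hbase : 1 / (2 * d) * (a / A) ≤ (1 / (d : ℝ)) ^ (n + 1) := by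
      rw [pow_succ]
      calc 1 / (2 * d) * (a / A) = a / (2 * A) * (1 / d) := by field_simp
        _ ≤ _ := by gcongr
    have hconst : 1 / (2 * (d : ℝ)) ≤ (1 / (2 * (d : ℝ))) ^ (1 - 1 / p) := by
      refine Real.self_le_rpow_of_le_one (by positivity) ?_ (by linarith)
      rw [div_le_one (by positivity)]; linarith
    have hsplit : A ^ (1 / p) * (a / A) = (a / A) ^ (1 - 1 / p) * a ^ (1 / p) := by
      rw [Real.rpow_sub (by positivity), Real.rpow_one, Real.div_rpow ha.le hA.le]
      have := Real.rpow_pos_of_pos ha (1 / p)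
      have := Real.rpow_pos_of_pos hA (1 / p)
      field_simp
    calc 1 / (2 * d) * A ^ (1 / p) * (a / A)
        = 1 / (2 * d) * ((a / A) ^ (1 - 1 / p) * a ^ (1 / p)) := by rw [mul_assoc, hsplit]
      _ ≤ (1 / (2 * (d : ℝ))) ^ (1 - 1 / p) * ((a / A) ^ (1 - 1 / p) * a ^ (1 / p)) := by gcongr
      _ = (1 / (2 * d) * (a / A)) ^ (1 - 1 / p) * a ^ (1 / p) := by
          rw [Real.mul_rpow (by positivity) (by positivity), mul_assoc]
      _ ≤ θ ^ (n + 1) * a ^ (1 / p) := by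
          rw [hpow]
          have : 0 ≤ 1 - 1 / p := by linarith
          gcongr

lemma powSum_le_tnorm {k d : ℕ} (hk : 1 ≤ k) {θ p : ℝ} (hθ0 : 0 < θ) (hθ1 : θ < 1)
    (hd : 2 ≤ d) (hp : 1 < p) (hdp : (d : ℝ) * θ = (d : ℝ) ^ (1 / p))
    {s : List ℕ} (hsl : s.length = k - 1) (x : Vec k →₀ ℝ) (hs : ∀ w ∈ x.support, s <+: w.1) :
    1 / (2 * d) * powSum p x ^ (1 / p) ≤ tnorm k d θ x := by
  have hd1 : 1 ≤ d := by omega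
  have hbdd : BddAbove (Set.range fun j => normSeq k d θ j x) :=
    ⟨powSum p x ^ (1 / p), by
      rintro _ ⟨j, rfl⟩; exact normSeq_le_powSum hθ0 hd1 hp hdp j x⟩
  have hpos : ∀ w ∈ x.support, 0 < |x w| ^ p := fun w hw =>
    Real.rpow_pos_of_pos (abs_pos.2 (Finsupp.mem_support_iff.1 hw)) _
  have hle : ∀ w ∈ x.support, |x w| ^ p ≤ powSum p x := fun w hw =>
    Finset.single_le_sum (f := fun w => |x w| ^ p) (fun _ _ => by positivity) hw
  have hdepth : ∀ w, ∃ ℓ : ℕ, w ∈ x.support → powSum p x ≤ |x w| ^ p / 2 * d ^ ℓ ∧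
      1 / (2 * d) * powSum p x ^ (1 / p) * (|x w| ^ p / powSum p x) ≤
        θ ^ ℓ * (|x w| ^ p) ^ (1 / p) := by
    intro w
    by_cases hw : w ∈ x.support
    · obtain ⟨ℓ, h⟩ := exists_depth hd hp hdp (hpos w hw) (hle w hw)
      exact ⟨ℓ, fun _ => h⟩
    · exact ⟨0, fun h => absurd h hw⟩
  choose ℓ hℓ using hdepth
  set below : Vec k → Finset (Vec k) := fun w =>
    x.support.filter fun w' => w'.1.getLast! < w.1.getLast! with hbelow
  set y : Vec k → ℝ := fun w => (∑ w' ∈ below w, |x w'| ^ p) + |x w| ^ p / 2 with hy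
  have hinsert : ∀ (w : Vec k) (t : Finset (Vec k)), w ∈ t → below w ⊆ t →
      (∑ w' ∈ below w, |x w'| ^ p) + |x w| ^ p ≤ ∑ w' ∈ t, |x w'| ^ p := by
    intro w t hw ht
    rw [add_comm, ← Finset.sum_insert (s := below w) (a := w)
      (f := fun w' => |x w'| ^ p) (by simp [hbelow])]
    exact Finset.sum_le_sum_of_subset_of_nonneg (Finset.insert_subset hw ht)
      fun _ _ _ => by positivity
  have hmain := sum_pow_mul_abs_le_normSeq hk hθ0 hθ1 hd1 hp hdp hsl y
    (fun w => |x w| ^ p / 2) (x.support.sup ℓ) x ℓ 0 (powSum p x) hs ?_ ?_ ?_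
  · refine le_trans ?_ (hmain.trans (le_ciSup hbdd _))
    rcases (powSum_nonneg p x).eq_or_lt with h0 | h0
    · rw [← h0, Real.zero_rpow (by positivity), mul_zero]
      exact Finset.sum_nonneg fun w _ => by positivity
    calc 1 / (2 * d) * powSum p x ^ (1 / p)
        = ∑ w ∈ x.support, 1 / (2 * d) * powSum p x ^ (1 / p) * (|x w| ^ p / powSum p x) := by
          rw [← Finset.mul_sum, ← Finset.sum_div]
          change _ = _ * (powSum p x / powSum p x)
          rw [div_self h0.ne', mul_one]
      _ ≤ _ := by
          refine Finset.sum_le_sum fun w hw => ?_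
          have := (hℓ w hw).2
          rwa [one_div p, Real.rpow_rpow_inv (abs_nonneg _) (by positivity), ← one_div p] at this
  · intro w hw
    have h1 := hinsert w x.support hw (Finset.filter_subset _ _)
    have h2 : 0 ≤ ∑ w' ∈ below w, |x w'| ^ p := Finset.sum_nonneg fun _ _ => by positivity
    have h3 := hpos w hw
    change _ ≤ powSum p x at h1
    constructor <;> simp only [hy] <;> linarith
  · intro w hw w' hw' hlt
    have h1 := hinsert w (below w') (Finset.mem_filter.2 ⟨hw, hlt⟩) fun v hv => by
      rw [hbelow, Finset.mem_filter] at hv ⊢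
      exact ⟨hv.1, hv.2.trans hlt⟩
    have h2 := hpos w hw
    have h3 := hpos w' hw'
    constructor <;> simp only [hy] <;> linarith
  · exact fun w hw => ⟨half_pos (hpos w hw), (hℓ w hw).1, Finset.le_sup hw⟩

/-- if `s` has length `k - 1`, then `T^k[s]` is isomorphic to `ℓ_p`:
the `T_k(d,θ)`-norm is equivalent, on vectors supported in `τ^k[s]`, to the
`ℓ_p`-norm, where `dθ = d^{1/p}`. -/
theorem tree_space_isomorphic_lp (k d : ℕ) (hk : 1 ≤ k) (hd : 2 ≤ d)
    (θ : ℝ) (hθ0 : 0 < θ) (hθ1 : θ < 1)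
    (hdθ : 1 < (d : ℝ) * θ) (p : ℝ) (hp : 1 < p)
    (hdp : (d : ℝ) * θ = (d : ℝ) ^ (1 / p))
    (s : List ℕ) (hs : NonDec s) (hsl : s.length = k - 1) :
    ∃ C > (0 : ℝ), ∀ x : Vec k →₀ ℝ, (∀ w ∈ x.support, s <+: w.1) →
      (1 / C) * (∑ w ∈ x.support, |x w| ^ p) ^ (1 / p) ≤ tnorm k d θ x ∧
      tnorm k d θ x ≤ C * (∑ w ∈ x.support, |x w| ^ p) ^ (1 / p) := by
  have hd2 : (2 : ℝ) ≤ d := by exact_mod_cast hd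
  refine ⟨2 * d, by positivity, fun x hx =>
    ⟨powSum_le_tnorm hk hθ0 hθ1 hd hp hdp hsl x hx, ?_⟩⟩
  have hnn : 0 ≤ powSum p x ^ (1 / p) := Real.rpow_nonneg (powSum_nonneg _ _) _
  calc tnorm k d θ x ≤ powSum p x ^ (1 / p) :=
        ciSup_le fun j => normSeq_le_powSum hθ0 (by omega) hp hdp j x
    _ ≤ 2 * d * powSum p x ^ (1 / p) := le_mul_of_one_le_left hnn (by linarith)
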